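/- Let (x*,λ*) be a saddle point of L, assume β(t) = μ e^{t/δ} with μ > 0 and γδ > 1, and let (x,λ) be a global solution of the perturbed primal-dual dynamical system. Then there exist constants C₁, C₂ ≥ 0 such that |f(x(t)) − f(x*)| ≤ C₁ e^{−t/δ} and ‖Ax(t) − b‖ ≤ C₂ e^{−t/δ} for all t ≥ t₀. -/

import Mathlib

open scoped RealInnerProductSpace
open MeasureTheory Set

noncomputable def Lagr {n m : ℕ} (f : EuclideanSpace ℝ (Fin n) → ℝ)
    (A : EuclideanSpace ℝ (Fin n) →L[ℝ] EuclideanSpace ℝ (Fin m))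
    (b : EuclideanSpace ℝ (Fin m))
    (x : EuclideanSpace ℝ (Fin n)) (lam : EuclideanSpace ℝ (Fin m)) : ℝ :=
  f x + ⟪lam, A x - b⟫

noncomputable def AugLagr {n m : ℕ} (f : EuclideanSpace ℝ (Fin n) → ℝ)
    (A : EuclideanSpace ℝ (Fin n) →L[ℝ] EuclideanSpace ℝ (Fin m))
    (b : EuclideanSpace ℝ (Fin m)) (σ : ℝ)
    (x : EuclideanSpace ℝ (Fin n)) (lam : EuclideanSpace ℝ (Fin m)) : ℝ :=
  Lagr f A b x lam + σ / 2 * ‖A x - b‖ ^ 2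

def IsSaddlePoint {n m : ℕ} (f : EuclideanSpace ℝ (Fin n) → ℝ)
    (A : EuclideanSpace ℝ (Fin n) →L[ℝ] EuclideanSpace ℝ (Fin m))
    (b : EuclideanSpace ℝ (Fin m))
    (xs : EuclideanSpace ℝ (Fin n)) (ls : EuclideanSpace ℝ (Fin m)) : Prop :=
  ∀ x lam, Lagr f A b xs lam ≤ Lagr f A b xs ls ∧ Lagr f A b xs ls ≤ Lagr f A b x ls

theorem ConvexOn.add_inner_gradient_le {X : Type*} [NormedAddCommGroup X] [InnerProductSpace ℝ X]
    [CompleteSpace X] {f : X → ℝ} (hf : ConvexOn ℝ univ f) {x : X}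
    (hd : DifferentiableAt ℝ f x) (y : X) : f x + ⟪gradient f x, y - x⟫ ≤ f y := by
  let g : ℝ →ᵃ[ℝ] X := AffineMap.lineMap x y
  have hconv : ConvexOn ℝ univ (f ∘ g) := by simpa using hf.comp_affineMap g
  have hderiv : HasDerivAt (f ∘ g) ⟪gradient f x, y - x⟫ 0 := by
    have hg : HasDerivAt g (y - x) 0 := AffineMap.hasDerivAt_lineMap
    have hfg : HasFDerivAt f (InnerProductSpace.toDual ℝ X (gradient f x)) (g 0) := by
      simpa [g] using hd.hasGradientAt.hasFDerivAt
    simpa using hfg.comp_hasDerivAt 0 hg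
  have h := hconv.le_slope_of_hasDerivAt (mem_univ 0) (mem_univ 1) one_pos hderiv
  simp only [slope_def_field, Function.comp_apply, g, AffineMap.lineMap_apply_zero,
    AffineMap.lineMap_apply_one, sub_zero, div_one] at h
  linarith

/-- A Grönwall bound for an integrable coefficient on a half-line. -/
theorem exists_bound_of_hasDerivWithinAt_le_mul {t₀ c : ℝ} {E E' g : ℝ → ℝ}
    (hE : ∀ t ∈ Ici t₀, HasDerivWithinAt E (E' t) (Ici t₀) t)
    (hgcont : ContinuousOn g (Ici t₀)) (hgint : IntegrableOn g (Ici t₀))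
    (hg : ∀ t ∈ Ici t₀, 0 ≤ g t) (hle : ∀ t ∈ Ici t₀, E' t ≤ g t * (E t + c))
    (h0 : 0 ≤ E t₀ + c) :
    ∃ M, ∀ t ∈ Ici t₀, E t ≤ M := by
  let K : ℝ → ℝ := fun t => ∫ s in t₀..t, g (max s t₀)
  have hcont : Continuous fun s => g (max s t₀) :=
    hgcont.comp_continuous (by fun_prop) fun s => le_max_right s t₀
  have hK : ∀ t ∈ Ici t₀, HasDerivWithinAt K (g t) (Ici t₀) t := fun t ht => by
    have h := (hcont.integral_hasStrictDerivAt t₀ t).hasDerivAt.hasDerivWithinAt (s := Ici t₀)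
    rwa [max_eq_left (mem_Ici.mp ht)] at h
  have hKle : ∀ t ∈ Ici t₀, K t ≤ ∫ s in Ici t₀, g s := fun t ht => by
    have hKt : K t = ∫ s in Ioc t₀ t, g s := by
      simp only [K, intervalIntegral.integral_of_le (mem_Ici.mp ht)]
      exact setIntegral_congr_fun measurableSet_Ioc fun s hs => by
        simp only [max_eq_left hs.1.le]
    rw [hKt]
    exact setIntegral_mono_set hgint
      ((ae_restrict_iff' measurableSet_Ici).mpr (Filter.Eventually.of_forall hg))
      (LE.le.eventuallyLE fun s hs => hs.1.le)
  have hW : ∀ t ∈ Ici t₀, HasDerivWithinAt (fun s => (E s + c) * Real.exp (-K s))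
      (E' t * Real.exp (-K t) + (E t + c) * (Real.exp (-K t) * -g t)) (Ici t₀) t := fun t ht =>
    ((hE t ht).add_const c).mul (hK t ht).neg.exp
  have hanti : AntitoneOn (fun s => (E s + c) * Real.exp (-K s)) (Ici t₀) := by
    refine antitoneOn_of_hasDerivWithinAt_nonpos (convex_Ici t₀)
      (fun t ht => (hW t ht).continuousWithinAt)
      (fun t ht => (hW t (interior_subset ht)).mono interior_subset) fun t ht => ?_
    have h := mul_le_mul_of_nonneg_right (hle t (interior_subset ht)) (Real.exp_pos (-K t)).le
    linarith
  refine ⟨(E t₀ + c) * Real.exp (∫ s in Ici t₀, g s) - c, fun t ht => ?_⟩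
  have h1 : (E t + c) * Real.exp (-K t) ≤ E t₀ + c := by
    simpa [K] using hanti self_mem_Ici ht ht
  have h2 : E t + c ≤ (E t₀ + c) * Real.exp (K t) := by
    rw [Real.exp_neg, ← div_eq_mul_inv, div_le_iff₀ (Real.exp_pos _)] at h1
    exact h1
  have h3 : (E t₀ + c) * Real.exp (K t) ≤ (E t₀ + c) * Real.exp (∫ s in Ici t₀, g s) := by
    gcongr
    exact hKle t ht
  linarith

theorem perturbed_exponential_rates
    {n m : ℕ}
    (f : EuclideanSpace ℝ (Fin n) → ℝ)
    (hf_conv : ConvexOn ℝ Set.univ f)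
    (hf_smooth : ContDiff ℝ 1 f)
    (A : EuclideanSpace ℝ (Fin n) →L[ℝ] EuclideanSpace ℝ (Fin m))
    (b : EuclideanSpace ℝ (Fin m))
    (t₀ γ δ σ : ℝ) (ht₀ : 0 ≤ t₀) (hγ : 0 < γ) (hδ : 0 < δ) (hσ : 0 < σ)
    (μ : ℝ) (hμ : 0 < μ) (hγδ : 1 < γ * δ)
    (β : ℝ → ℝ) (hβeq : ∀ t, β t = μ * Real.exp (t / δ))
    (xs : EuclideanSpace ℝ (Fin n)) (ls : EuclideanSpace ℝ (Fin m))
    (hsaddle : IsSaddlePoint f A b xs ls)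
    (ε : ℝ → EuclideanSpace ℝ (Fin n))
    (hεcont : ContinuousOn ε (Ici t₀))
    (hεint : IntegrableOn (fun t => ‖ε t‖) (Ici t₀))
    (x x' x'' : ℝ → EuclideanSpace ℝ (Fin n))
    (lam lam' : ℝ → EuclideanSpace ℝ (Fin m))
    (hx : ∀ t ∈ Ici t₀, HasDerivWithinAt x (x' t) (Ici t₀) t)
    (hx' : ∀ t ∈ Ici t₀, HasDerivWithinAt x' (x'' t) (Ici t₀) t)
    (hx''cont : ContinuousOn x'' (Ici t₀))
    (hlam : ∀ t ∈ Ici t₀, HasDerivWithinAt lam (lam' t) (Ici t₀) t)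
    (hlam'cont : ContinuousOn lam' (Ici t₀))
    (hode1 : ∀ t ∈ Ici t₀, x'' t + γ • x' t =
      -(β t) • (gradient f (x t) + A.adjoint (lam t) + σ • A.adjoint (A (x t) - b)) + ε t)
    (hode2 : ∀ t ∈ Ici t₀, lam' t = β t • (A (x t + δ • x' t) - b))
    :
    ∃ C₁ C₂ : ℝ, 0 ≤ C₁ ∧ 0 ≤ C₂ ∧ ∀ t ∈ Ici t₀,
      |f (x t) - f xs| ≤ C₁ * Real.exp (-t / δ) ∧
      ‖A (x t) - b‖ ≤ C₂ * Real.exp (-t / δ) := by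
  have hAxs : A xs = b := by
    have h := (hsaddle xs (ls + (A xs - b))).1
    simp only [Lagr, inner_add_left, real_inner_self_eq_norm_sq] at h
    have h' : ‖A xs - b‖ ^ 2 ≤ 0 := by linarith
    exact sub_eq_zero.mp (norm_eq_zero.mp (pow_eq_zero_iff two_ne_zero |>.mp
      (le_antisymm h' (sq_nonneg _))))
  have hgap : ∀ y, 0 ≤ f y - f xs + ⟪ls, A y - b⟫ := fun y => by
    have h := (hsaddle y ls).2
    simp only [Lagr, hAxs, sub_self, inner_zero_right] at h
    linarith
  have hβpos : ∀ t, 0 < β t := fun t => by rw [hβeq]; positivity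
  have hβ' : ∀ t, HasDerivAt β (β t / δ) t := fun t => by
    have h := (((hasDerivAt_id t).div_const δ).exp).const_mul μ
    have hfun : β = fun s => μ * Real.exp (id s / δ) := funext hβeq
    rw [hfun]
    exact h.congr_deriv (by simp only [id]; ring)
  have hA : ∀ t ∈ Ici t₀, HasDerivWithinAt (fun s => A (x s) - b) (A (x' t)) (Ici t₀) t :=
    fun t ht => (A.hasFDerivAt.comp_hasDerivWithinAt t (hx t ht)).sub_const b
  have hfx : ∀ t ∈ Ici t₀, HasDerivWithinAt (fun s => f (x s)) ⟪gradient f (x t), x' t⟫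
      (Ici t₀) t := fun t ht => by
    have h := ((hf_smooth.differentiable one_ne_zero (x t)).hasGradientAt).hasFDerivAt
    exact (h.comp_hasDerivWithinAt t (hx t ht)).congr_deriv (by simp)
  let F : ℝ → ℝ := fun t => f (x t) - f xs + ⟪ls, A (x t) - b⟫ + σ / 2 * ‖A (x t) - b‖ ^ 2
  let F' : ℝ → ℝ := fun t => ⟪gradient f (x t), x' t⟫ + ⟪ls, A (x' t)⟫ +
    σ / 2 * (2 * ⟪A (x t) - b, A (x' t)⟫)
  have hF : ∀ t ∈ Ici t₀, HasDerivWithinAt F (F' t) (Ici t₀) t := fun t ht => by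
    have h := (((hfx t ht).sub_const (f xs)).add
      ((hasDerivWithinAt_const t (Ici t₀) ls).inner ℝ (hA t ht))).add
      ((hA t ht).norm_sq.const_mul (σ / 2))
    exact h.congr_deriv (by simp [F'])
  have hFgap : ∀ t, f (x t) - f xs + ⟪ls, A (x t) - b⟫ ≤ F t := fun t =>
    le_add_of_nonneg_right (by positivity)
  have hFnonneg : ∀ t, 0 ≤ F t := fun t => (hgap (x t)).trans (hFgap t)
  let v : ℝ → EuclideanSpace ℝ (Fin n) := fun t => x t - xs + δ • x' t
  let v' : ℝ → EuclideanSpace ℝ (Fin n) := fun t => x' t + δ • x'' t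
  have hv : ∀ t ∈ Ici t₀, HasDerivWithinAt v (v' t) (Ici t₀) t := fun t ht =>
    ((hx t ht).sub_const xs).add ((hx' t ht).const_smul δ)
  let E : ℝ → ℝ := fun t => δ ^ 2 * (β t * F t) + 1 / 2 * ‖v t‖ ^ 2 +
    (δ * γ - 1) / 2 * ‖x t - xs‖ ^ 2 + δ / 2 * ‖lam t - ls‖ ^ 2
  let E' : ℝ → ℝ := fun t => δ ^ 2 * (β t / δ * F t + β t * F' t) + 1 / 2 * (2 * ⟪v t, v' t⟫) +
    (δ * γ - 1) / 2 * (2 * ⟪x t - xs, x' t⟫) + δ / 2 * (2 * ⟪lam t - ls, lam' t⟫)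
  have hE : ∀ t ∈ Ici t₀, HasDerivWithinAt E (E' t) (Ici t₀) t := fun t ht =>
    ((((((hβ' t).hasDerivWithinAt.mul (hF t ht)).const_mul (δ ^ 2)).add
      ((hv t ht).norm_sq.const_mul (1 / 2))).add
      (((hx t ht).sub_const xs).norm_sq.const_mul ((δ * γ - 1) / 2))).add
      (((hlam t ht).sub_const ls).norm_sq.const_mul (δ / 2)))
  have hγδ' : 0 < δ * γ - 1 := by linarith
  have hEF : ∀ t, δ ^ 2 * (β t * F t) ≤ E t := fun t => by
    have h1 : 0 ≤ (δ * γ - 1) / 2 * ‖x t - xs‖ ^ 2 := by positivity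
    have h2 : 0 ≤ δ / 2 * ‖lam t - ls‖ ^ 2 := by positivity
    simp only [E]
    linarith [sq_nonneg ‖v t‖]
  have hEv : ∀ t, 1 / 2 * ‖v t‖ ^ 2 ≤ E t := fun t => by
    have h1 : 0 ≤ (δ * γ - 1) / 2 * ‖x t - xs‖ ^ 2 := by positivity
    have h2 : 0 ≤ δ / 2 * ‖lam t - ls‖ ^ 2 := by positivity
    have h3 := mul_nonneg (sq_nonneg δ) (mul_nonneg (hβpos t).le (hFnonneg t))
    simp only [E]
    linarith
  have hElam : ∀ t, δ / 2 * ‖lam t - ls‖ ^ 2 ≤ E t := fun t => by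
    have h1 : 0 ≤ (δ * γ - 1) / 2 * ‖x t - xs‖ ^ 2 := by positivity
    have h3 := mul_nonneg (sq_nonneg δ) (mul_nonneg (hβpos t).le (hFnonneg t))
    simp only [E]
    linarith [sq_nonneg ‖v t‖]
  have hE'le : ∀ t ∈ Ici t₀, E' t ≤ δ * ‖ε t‖ * (E t + 1 / 2) := fun t ht => by
    have hv't : v' t = (1 - δ * γ) • x' t - (δ * β t) • (gradient f (x t) +
        A.adjoint (lam t) + σ • A.adjoint (A (x t) - b)) + δ • ε t := by
      have h : x'' t = -(β t) • (gradient f (x t) + A.adjoint (lam t) +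
          σ • A.adjoint (A (x t) - b)) + ε t - γ • x' t := eq_sub_of_add_eq (hode1 t ht)
      simp only [v', h]
      module
    have hlam't : lam' t = β t • ((A (x t) - b) + δ • A (x' t)) := by
      rw [hode2 t ht, map_add, map_smul]
      module
    have hAdiff : A (x t - xs) = A (x t) - b := by rw [map_sub, hAxs]
    have hconv := hf_conv.add_inner_gradient_le (hf_smooth.differentiable one_ne_zero (x t)) xs
    rw [← neg_sub (x t) xs, inner_neg_right] at hconv
    have hgrad : F t + σ / 2 * ‖A (x t) - b‖ ^ 2 ≤
        ⟪gradient f (x t), x t - xs⟫ + ⟪ls, A (x t) - b⟫ + σ * ‖A (x t) - b‖ ^ 2 := by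
      simp only [F]
      linarith
    have hvε : ⟪v t, ε t⟫ ≤ ‖ε t‖ * (E t + 1 / 2) := by
      calc ⟪v t, ε t⟫ ≤ ‖v t‖ * ‖ε t‖ := real_inner_le_norm _ _
        _ = ‖ε t‖ * ‖v t‖ := mul_comm _ _
        _ ≤ ‖ε t‖ * (E t + 1 / 2) := by
          gcongr
          linarith [hEv t, sq_nonneg (‖v t‖ - 1)]
    have hE't : E' t = δ * β t * (F t - (⟪gradient f (x t), x t - xs⟫ + ⟪ls, A (x t) - b⟫ +
        σ * ‖A (x t) - b‖ ^ 2)) - δ * (δ * γ - 1) * ‖x' t‖ ^ 2 + δ * ⟪v t, ε t⟫ := by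
      have hv_inner : ⟪v t, v' t⟫ = (1 - δ * γ) * (⟪x t - xs, x' t⟫ + δ * ‖x' t‖ ^ 2) -
          δ * β t * (⟪gradient f (x t), x t - xs⟫ + δ * ⟪gradient f (x t), x' t⟫ +
            (⟪lam t, A (x t) - b⟫ + δ * ⟪lam t, A (x' t)⟫) +
            σ * (‖A (x t) - b‖ ^ 2 + δ * ⟪A (x t) - b, A (x' t)⟫)) + δ * ⟪v t, ε t⟫ := by
        rw [hv't, inner_add_right, inner_sub_right, real_inner_smul_right, real_inner_smul_right,
          real_inner_smul_right, inner_add_right, inner_add_right, real_inner_smul_right,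
          ContinuousLinearMap.adjoint_inner_right, ContinuousLinearMap.adjoint_inner_right]
        have hAv : A (v t) = (A (x t) - b) + δ • A (x' t) := by
          simp only [v, map_add, map_smul, hAdiff]
        rw [hAv]
        simp only [v, inner_add_left, real_inner_smul_left, real_inner_self_eq_norm_sq]
        rw [real_inner_comm (gradient f (x t)) (x t - xs), real_inner_comm (gradient f (x t)) (x' t),
          real_inner_comm (lam t) (A (x t) - b), real_inner_comm (lam t) (A (x' t)),
          real_inner_comm (A (x t) - b) (A (x' t))]
      simp only [E', hv_inner, F', hlam't, real_inner_smul_right, inner_add_right, inner_sub_left]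
      field_simp
      ring
    rw [hE't]
    have h1 : 0 ≤ δ * (δ * γ - 1) * ‖x' t‖ ^ 2 := by positivity
    have h2 : δ * β t * (F t - (⟪gradient f (x t), x t - xs⟫ + ⟪ls, A (x t) - b⟫ +
        σ * ‖A (x t) - b‖ ^ 2)) ≤ 0 := by
      refine mul_nonpos_of_nonneg_of_nonpos (mul_nonneg hδ.le (hβpos t).le) ?_
      have : 0 ≤ σ / 2 * ‖A (x t) - b‖ ^ 2 := by positivity
      linarith
    have h3 := mul_le_mul_of_nonneg_left hvε hδ.le
    linarith
  obtain ⟨M, hM⟩ := exists_bound_of_hasDerivWithinAt_le_mul hE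
    (continuousOn_const.mul hεcont.norm) (hεint.const_mul δ)
    (fun t _ => mul_nonneg hδ.le (norm_nonneg _)) hE'le
    (by linarith [hEv t₀, sq_nonneg ‖v t₀‖])
  have hM0 : 0 ≤ M := by linarith [hM t₀ self_mem_Ici, hEv t₀, sq_nonneg ‖v t₀‖]
  have hresid : ∀ t ∈ Ici t₀, Real.exp (t / δ) • (A (x t) - b) - (1 / (δ * μ)) • lam t =
      Real.exp (t₀ / δ) • (A (x t₀) - b) - (1 / (δ * μ)) • lam t₀ := by
    have hderiv : ∀ t ∈ Ici t₀, HasDerivWithinAt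
        (fun s => Real.exp (s / δ) • (A (x s) - b) - (1 / (δ * μ)) • lam s) 0 (Ici t₀) t :=
      fun t ht => by
        have h := ((((hasDerivAt_id t).div_const δ).exp.hasDerivWithinAt (s := Ici t₀)).smul
          (hA t ht)).sub ((hlam t ht).const_smul (1 / (δ * μ)))
        refine h.congr_deriv ?_
        rw [hode2 t ht, hβeq, map_add, map_smul]
        simp only [id]
        match_scalars <;> field_simp <;> ring
    intro t ht
    exact (convex_Ici t₀).is_const_of_fderivWithin_eq_zero (𝕜 := ℝ)
      (f := fun s => Real.exp (s / δ) • (A (x s) - b) - (1 / (δ * μ)) • lam s)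
      (fun s hs => (hderiv s hs).differentiableWithinAt)
      (fun s hs => by
        rw [(hderiv s hs).hasFDerivWithinAt.fderivWithin (uniqueDiffOn_Ici t₀ s hs)]
        ext
        simp) ht self_mem_Ici
  let R : ℝ := ‖Real.exp (t₀ / δ) • (A (x t₀) - b) - (1 / (δ * μ)) • lam t₀‖ +
    1 / (δ * μ) * (‖ls‖ + (1 + 2 * M / δ))
  have hR0 : 0 ≤ R := by positivity
  have hexp : ∀ t, Real.exp (-t / δ) = (Real.exp (t / δ))⁻¹ := fun t => by
    rw [neg_div, Real.exp_neg]
  have hR : ∀ t ∈ Ici t₀, ‖A (x t) - b‖ ≤ R * Real.exp (-t / δ) := fun t ht => by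
    have hlamle : ‖lam t - ls‖ ≤ 1 + 2 * M / δ := by
      have h : ‖lam t - ls‖ ^ 2 ≤ 2 * M / δ := by
        rw [le_div_iff₀ hδ]
        linarith [hElam t, hM t ht]
      nlinarith [sq_nonneg (‖lam t - ls‖ - 1), sq_nonneg ‖lam t - ls‖]
    have hlamnorm : ‖lam t‖ ≤ ‖ls‖ + (1 + 2 * M / δ) := by
      linarith [norm_le_norm_add_norm_sub' (lam t) ls]
    have h1 : Real.exp (t / δ) * ‖A (x t) - b‖ ≤ R := by
      calc Real.exp (t / δ) * ‖A (x t) - b‖ = ‖Real.exp (t / δ) • (A (x t) - b)‖ := by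
            rw [norm_smul, Real.norm_of_nonneg (Real.exp_pos _).le]
        _ = ‖(Real.exp (t₀ / δ) • (A (x t₀) - b) - (1 / (δ * μ)) • lam t₀) +
              (1 / (δ * μ)) • lam t‖ := by rw [← hresid t ht, sub_add_cancel]
        _ ≤ _ := norm_add_le _ _
        _ ≤ R := by
            rw [norm_smul, Real.norm_of_nonneg (by positivity : 0 ≤ 1 / (δ * μ))]
            simp only [R]
            gcongr
    rw [hexp, ← div_eq_mul_inv, le_div_iff₀ (Real.exp_pos _)]
    linarith
  refine ⟨M / (δ ^ 2 * μ) + ‖ls‖ * R, R, by positivity, hR0, fun t ht => ⟨?_, hR t ht⟩⟩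
  have hFle : F t ≤ M / (δ ^ 2 * μ) * Real.exp (-t / δ) := by
    have h := (hEF t).trans (hM t ht)
    rw [hβeq] at h
    rw [hexp, ← div_eq_mul_inv, div_div, le_div_iff₀ (by positivity)]
    linarith
  have hinner : |⟪ls, A (x t) - b⟫| ≤ ‖ls‖ * (R * Real.exp (-t / δ)) :=
    (abs_real_inner_le_norm _ _).trans (mul_le_mul_of_nonneg_left (hR t ht) (norm_nonneg _))
  have hMexp : 0 ≤ M / (δ ^ 2 * μ) * Real.exp (-t / δ) := by positivity
  rw [abs_le] at hinner ⊢
  constructor <;> linarith [hgap (x t), hFgap t, hinner.1, hinner.2]
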